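/- Let A be an antimatroid with ground set E, and suppose A is not equal to the full power set of E. Then there exists a set S ⊆ E with S ∉ A such that A ∪ {S} is also an antimatroid (with the same ground set E). -/

import Mathlib

variable {α : Type*} [DecidableEq α]

/-- An *antimatroid* is a (nonempty) finite family of finite sets that is accessible —
every nonempty member has an element whose removal leaves a member — and closed under
unions. -/
def IsAntimatroid (A : Finset (Finset α)) : Prop :=
  A.Nonempty ∧
  (∀ S ∈ A, S.Nonempty → ∃ x ∈ S, S.erase x ∈ A) ∧
  (∀ S ∈ A, ∀ T ∈ A, S ∪ T ∈ A)

/-- If the antimatroid `A` is not the full power set of its ground set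
`E = ⋃ A`, then some set `S ⊆ E` with `S ∉ A` can be added to `A` so that the result is
again an antimatroid with the same ground set. -/
theorem exists_insert_isAntimatroid (A : Finset (Finset α)) (hA : IsAntimatroid A)
    (hne : A ≠ (A.sup id).powerset) :
    ∃ S : Finset α, S ⊆ A.sup id ∧ S ∉ A ∧ IsAntimatroid (insert S A) ∧
      (insert S A).sup id = A.sup id := by
  obtain ⟨⟨R, hR⟩, hacc, hun⟩ := hA
  have hempty : ∅ ∈ A := by
    obtain ⟨M, hM, hmin⟩ := A.exists_min_image Finset.card ⟨R, hR⟩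
    rcases M.eq_empty_or_nonempty with rfl | hMne
    · exact hM
    · obtain ⟨x, hx, hxM⟩ := hacc M hM hMne
      exact absurd (hmin _ hxM) (Finset.card_erase_lt_of_mem hx).not_ge
  have hsub : ∀ T ∈ A, T ⊆ A.sup id := fun T hT => Finset.le_sup (f := id) hT
  -- The feasible sets that have an infeasible one-element extension inside the ground set.
  let B := A.filter fun T => ∃ x ∈ A.sup id, insert x T ∉ A
  have hB : B.Nonempty := by
    by_contra hB
    rw [Finset.not_nonempty_iff_eq_empty, Finset.filter_eq_empty_iff] at hB
    push Not at hB
    apply hne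
    ext U
    rw [Finset.mem_powerset]
    refine ⟨hsub U, fun hU => ?_⟩
    induction U using Finset.induction_on with
    | empty => exact hempty
    | insert x U _ ih =>
      rw [Finset.insert_subset_iff] at hU
      exact hB (ih hU.2) x hU.1
  obtain ⟨T, hTB, hmax⟩ := B.exists_max_image Finset.card hB
  obtain ⟨hT, x, hxE, hxT⟩ := Finset.mem_filter.mp hTB
  have hx : x ∉ T := fun h => hxT (by rwa [Finset.insert_eq_of_mem h])
  have hSE : insert x T ⊆ A.sup id := Finset.insert_subset hxE (hsub T hT)
  have hunion : ∀ U ∈ A, insert x T ∪ U ∈ insert (insert x T) A := by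
    intro U hU
    by_cases hUS : U ⊆ insert x T
    · rw [Finset.union_eq_left.mpr hUS]
      exact Finset.mem_insert_self _ _
    · refine Finset.mem_insert_of_mem ?_
      rw [Finset.insert_union]
      by_contra hbad
      have hle := hmax (T ∪ U) (Finset.mem_filter.mpr ⟨hun T hT U hU, x, hxE, hbad⟩)
      have heq := Finset.eq_of_subset_of_card_le Finset.subset_union_left hle
      exact hUS ((Finset.union_eq_left.mp heq.symm).trans (Finset.subset_insert x T))
  refine ⟨insert x T, hSE, hxT, ⟨Finset.insert_nonempty _ _, ?_, ?_⟩, ?_⟩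
  · intro U hU hUne
    rcases Finset.mem_insert.mp hU with rfl | hU
    · refine ⟨x, Finset.mem_insert_self x T, Finset.mem_insert_of_mem ?_⟩
      rwa [Finset.erase_insert hx]
    · obtain ⟨y, hy, hyU⟩ := hacc U hU hUne
      exact ⟨y, hy, Finset.mem_insert_of_mem hyU⟩
  · intro U hU V hV
    rcases Finset.mem_insert.mp hU with rfl | hU
    · rcases Finset.mem_insert.mp hV with rfl | hV
      · rwa [Finset.union_self]
      · exact hunion V hV
    · rcases Finset.mem_insert.mp hV with rfl | hV
      · rw [Finset.union_comm]
        exact hunion U hU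
      · exact Finset.mem_insert_of_mem (hun U hU V hV)
  · rw [Finset.sup_insert]
    exact sup_eq_right.mpr hSE
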